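/- Let u ∈ V, let S ⊆ V∖{u}, let U := ∂u∖S be nonempty, and fix x_S ∈ {−1,+1}^S with P(X_S = x_S) > 0. Let Y be a random vector in {−1,+1}^U distributed as the conditional law of X_U given X_S = x_S and let g(y) := P(X_u = +1 | X_U = y, X_S = x_S). Then (1/2)·E[ (2g(Y) − 1)·( Σ_{i∈U} θ_{ui} Y_i − E[Σ_{i∈U} θ_{ui} Y_i] ) ] ≥ α²·δ^{4|U|+1}/8, and moreover α²·δ^{4|U|+1}/8 ≥ dβ·2τ* where τ* = α²·δ^{4d+1}/(16dβ). -/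

import Mathlib

noncomputable section

open Real Finset

/-- The spin value (±1) associated to a Boolean. -/
def spin (b : Bool) : ℝ := if b then 1 else -1

/-- The energy (Hamiltonian, without normalization) of a configuration of the Ising model:
`Σ_{{i,j}∈E} θ_{ij} x_i x_j + Σ_{i∈V} θ_i x_i`, where the sum over edges is written as half the
sum over ordered adjacent pairs (the edge couplings are symmetric). -/
def energy {p : ℕ} (G : SimpleGraph (Fin p)) [DecidableRel G.Adj]
    (θe : Fin p → Fin p → ℝ) (θv : Fin p → ℝ) (x : Fin p → Bool) : ℝ :=
  (∑ i, ∑ j, if G.Adj i j then θe i j * spin (x i) * spin (x j) else 0) / 2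
    + ∑ i, θv i * spin (x i)

/-- The Ising model probability mass function
`P(x) = exp(Σ_{{i,j}∈E} θ_{ij} x_i x_j + Σ_{i∈V} θ_i x_i − Φ(θ))`. -/
def isingPMF {p : ℕ} (G : SimpleGraph (Fin p)) [DecidableRel G.Adj]
    (θe : Fin p → Fin p → ℝ) (θv : Fin p → ℝ) (x : Fin p → Bool) : ℝ :=
  Real.exp (energy G θe θv x) / ∑ y : Fin p → Bool, Real.exp (energy G θe θv y)

open Classical in
/-- Probability of an event under a pmf on configurations. -/
def prob {p : ℕ} (μ : (Fin p → Bool) → ℝ) (A : (Fin p → Bool) → Prop) : ℝ :=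
  ∑ x : Fin p → Bool, if A x then μ x else 0

/-- Conditional probability `P(A | B)`. -/
def condProb {p : ℕ} (μ : (Fin p → Bool) → ℝ) (A B : (Fin p → Bool) → Prop) : ℝ :=
  prob μ (fun x => A x ∧ B x) / prob μ B

open Classical in
/-- Conditional expectation `E[f(X) | B]`. -/
def condExp {p : ℕ} (μ : (Fin p → Bool) → ℝ) (B : (Fin p → Bool) → Prop)
    (f : (Fin p → Bool) → ℝ) : ℝ :=
  (∑ x : Fin p → Bool, if B x then μ x * f x else 0) / prob μ B

/-- The event `X_S = σ_S` (agreement with `σ` on the set `S`). -/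
def agree {p : ℕ} (S : Finset (Fin p)) (σ : Fin p → Bool) (x : Fin p → Bool) : Prop :=
  ∀ i ∈ S, x i = σ i

/-- The conditional influence
`ν_{u|i;x_S} = P(X_u=+1 | X_i=+1, X_S=x_S) − P(X_u=+1 | X_i=−1, X_S=x_S)`. -/
def condInf {p : ℕ} (μ : (Fin p → Bool) → ℝ) (u i : Fin p) (S : Finset (Fin p))
    (σ : Fin p → Bool) : ℝ :=
  condProb μ (fun x => x u = true) (fun x => x i = true ∧ agree S σ x)
    - condProb μ (fun x => x u = true) (fun x => x i = false ∧ agree S σ x)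

/-- The weight `λ_i(x_S) = 2·P(X_i=+1|X_S=x_S)·P(X_i=−1|X_S=x_S)`. -/
def lamWeight {p : ℕ} (μ : (Fin p → Bool) → ℝ) (i : Fin p) (S : Finset (Fin p))
    (σ : Fin p → Bool) : ℝ :=
  2 * condProb μ (fun x => x i = true) (agree S σ)
    * condProb μ (fun x => x i = false) (agree S σ)

/-- The average conditional influence `ν̄(u,i,S) = E[λ_i(X_S)·|ν_{u|i;X_S}|]`, the expectation
over `X_S` with law the marginal of `μ` on `S` (the integrand depends on the configuration only
through its restriction to `S`). -/
def avgInf {p : ℕ} (μ : (Fin p → Bool) → ℝ) (u i : Fin p) (S : Finset (Fin p)) : ℝ :=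
  ∑ x : Fin p → Bool, μ x * (lamWeight μ i S x * |condInf μ u i S x|)

/-- `δ = (1/2)·e^{−2(βd+h)}`. -/
def deltaLB (β h : ℝ) (d : ℕ) : ℝ := (1/2) * Real.exp (-(2 * (β * d + h)))

/-- `τ* = α²·δ^{4d+1}/(16dβ)`. -/
def tauStar (α β h : ℝ) (d : ℕ) : ℝ :=
  α ^ 2 * (deltaLB β h d) ^ (4 * d + 1) / (16 * d * β)

/-- The conditional mutual information `I(X_u ; X_i | X_S)`, computed with natural logarithms,
written as the expectation of the log-likelihood ratio
`log( P(X_u,X_i,X_S)·P(X_S) / (P(X_u,X_S)·P(X_i,X_S)) )`. -/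
def condMI {p : ℕ} (μ : (Fin p → Bool) → ℝ) (u i : Fin p) (S : Finset (Fin p)) : ℝ :=
  ∑ x : Fin p → Bool, μ x * Real.log
    ((prob μ (fun z => z u = x u ∧ z i = x i ∧ agree S x z) * prob μ (agree S x))
      / (prob μ (fun z => z u = x u ∧ agree S x z)
          * prob μ (fun z => z i = x i ∧ agree S x z)))

/-- The configuration `x` with the spin at `v` reversed. -/
def flipAt {p : ℕ} (v : Fin p) (x : Fin p → Bool) : Fin p → Bool :=
  Function.update x v (!x v)

/-- The local field `θ_v + Σ_j θ_{vj} x_j` acting on the spin at `v`. -/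
def localField {p : ℕ} (θe : Fin p → Fin p → ℝ) (θv : Fin p → ℝ) (v : Fin p)
    (x : Fin p → Bool) : ℝ :=
  θv v + ∑ j, θe v j * spin (x j)

lemma flipAt_involutive {p : ℕ} (v : Fin p) : Function.Involutive (flipAt v) := by
  intro x
  simp [flipAt]

lemma flipAt_self {p : ℕ} (v : Fin p) (x : Fin p → Bool) : flipAt v x v = !x v := by
  simp [flipAt]

lemma flipAt_of_ne {p : ℕ} {v j : Fin p} (hj : j ≠ v) (x : Fin p → Bool) :
    flipAt v x j = x j := by
  simp [flipAt, hj]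

lemma sum_comp_flipAt {p : ℕ} (v : Fin p) (f : (Fin p → Bool) → ℝ) :
    ∑ x, f (flipAt v x) = ∑ x, f x :=
  Equiv.sum_comp (flipAt_involutive v).toPerm f

lemma agree_flipAt_iff {p : ℕ} {v : Fin p} {S : Finset (Fin p)} (hv : v ∉ S)
    (σ x : Fin p → Bool) : agree S σ (flipAt v x) ↔ agree S σ x := by
  refine forall₂_congr fun i hi => ?_
  rw [flipAt_of_ne (ne_of_mem_of_not_mem hi hv)]

lemma spin_eq_or (b : Bool) : spin b = 1 ∨ spin b = -1 := by
  cases b <;> simp [spin]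

lemma abs_spin (b : Bool) : |spin b| = 1 := by
  cases b <;> simp [spin]

lemma spin_not (b : Bool) : spin (!b) = -spin b := by
  cases b <;> simp [spin]

lemma spin_flipAt {p : ℕ} (v : Fin p) (x : Fin p → Bool) (j : Fin p) :
    spin (flipAt v x j) = spin (x j) + if j = v then -2 * spin (x v) else 0 := by
  by_cases hj : j = v
  · subst hj
    rw [flipAt_self, spin_not, if_pos rfl]
    ring
  · rw [flipAt_of_ne hj, if_neg hj, add_zero]

lemma energy_eq {p : ℕ} (G : SimpleGraph (Fin p)) [DecidableRel G.Adj]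
    (θe : Fin p → Fin p → ℝ) (θv : Fin p → ℝ)
    (hnonedge : ∀ i j, ¬ G.Adj i j → θe i j = 0) (x : Fin p → Bool) :
    energy G θe θv x = (∑ i, ∑ j, θe i j * spin (x i) * spin (x j)) / 2
      + ∑ i, θv i * spin (x i) := by
  unfold energy
  congr 2
  refine sum_congr rfl fun i _ => sum_congr rfl fun j _ => ?_
  split_ifs with hij
  · rfl
  · simp [hnonedge i j hij]

lemma energy_flipAt {p : ℕ} (G : SimpleGraph (Fin p)) [DecidableRel G.Adj]
    (θe : Fin p → Fin p → ℝ) (θv : Fin p → ℝ)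
    (hsym : ∀ i j, θe i j = θe j i)
    (hnonedge : ∀ i j, ¬ G.Adj i j → θe i j = 0) (v : Fin p) (x : Fin p → Bool) :
    energy G θe θv (flipAt v x)
      = energy G θe θv x - 2 * spin (x v) * localField θe θv v x := by
  have hdiag : θe v v = 0 := hnonedge v v (G.irrefl)
  have hcol : ∑ i, θe i v * spin (x i) = ∑ j, θe v j * spin (x j) :=
    sum_congr rfl fun i _ => by rw [hsym]
  have hrow : ∀ i, ∑ j, θe i j * spin (flipAt v x i) * spin (flipAt v x j)
      = spin (flipAt v x i) * (∑ j, θe i j * spin (x j))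
        + spin (flipAt v x i) * (θe i v * (-2 * spin (x v))) := by
    intro i
    rw [← mul_add, show θe i v * (-2 * spin (x v))
      = ∑ j, θe i j * (if j = v then -2 * spin (x v) else 0) by simp,
      ← sum_add_distrib, mul_sum]
    refine sum_congr rfl fun j _ => ?_
    rw [spin_flipAt v x j]
    ring
  have hquad : ∑ i, ∑ j, θe i j * spin (flipAt v x i) * spin (flipAt v x j)
      = (∑ i, ∑ j, θe i j * spin (x i) * spin (x j))
        - 4 * spin (x v) * ∑ j, θe v j * spin (x j) := by
    have h1 : ∑ i, spin (flipAt v x i) * (∑ j, θe i j * spin (x j))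
        = (∑ i, ∑ j, θe i j * spin (x i) * spin (x j))
          + (-2 * spin (x v)) * ∑ j, θe v j * spin (x j) := by
      simp_rw [spin_flipAt, add_mul, sum_add_distrib, ite_mul, zero_mul]
      rw [sum_ite_eq' univ v, if_pos (mem_univ v)]
      congr 1
      refine sum_congr rfl fun i _ => ?_
      rw [mul_sum]
      exact sum_congr rfl fun j _ => by ring
    have h2 : ∑ i, spin (flipAt v x i) * (θe i v * (-2 * spin (x v)))
        = (-2 * spin (x v)) * ∑ j, θe v j * spin (x j) := by
      simp_rw [spin_flipAt, add_mul, sum_add_distrib, ite_mul, zero_mul]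
      rw [sum_ite_eq' univ v, if_pos (mem_univ v), hdiag, ← hcol, mul_sum]
      simp only [zero_mul, mul_zero, add_zero]
      exact sum_congr rfl fun j _ => by ring
    rw [sum_congr rfl fun i _ => hrow i, sum_add_distrib, h1, h2]
    ring
  have hlin : ∑ i, θv i * spin (flipAt v x i)
      = ∑ i, θv i * spin (x i) - 2 * spin (x v) * θv v := by
    simp_rw [spin_flipAt, mul_add, sum_add_distrib, mul_ite, mul_zero]
    rw [sum_ite_eq' univ v, if_pos (mem_univ v)]
    ring
  rw [energy_eq G θe θv hnonedge, energy_eq G θe θv hnonedge, hquad, hlin, localField]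
  ring

lemma isingPMF_pos {p : ℕ} (G : SimpleGraph (Fin p)) [DecidableRel G.Adj]
    (θe : Fin p → Fin p → ℝ) (θv : Fin p → ℝ) (x : Fin p → Bool) :
    0 < isingPMF G θe θv x :=
  div_pos (exp_pos _) (sum_pos (fun _ _ => exp_pos _) univ_nonempty)

lemma isingPMF_flipAt {p : ℕ} (G : SimpleGraph (Fin p)) [DecidableRel G.Adj]
    (θe : Fin p → Fin p → ℝ) (θv : Fin p → ℝ)
    (hsym : ∀ i j, θe i j = θe j i)
    (hnonedge : ∀ i j, ¬ G.Adj i j → θe i j = 0) (v : Fin p) (x : Fin p → Bool) :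
    isingPMF G θe θv (flipAt v x)
      = Real.exp (-(2 * spin (x v) * localField θe θv v x)) * isingPMF G θe θv x := by
  rw [isingPMF, energy_flipAt G θe θv hsym hnonedge, sub_eq_add_neg, exp_add, isingPMF]
  ring

lemma abs_localField_le {p d : ℕ} (G : SimpleGraph (Fin p)) [DecidableRel G.Adj]
    (θe : Fin p → Fin p → ℝ) (θv : Fin p → ℝ) {β h : ℝ} (hβ : 0 ≤ β)
    (hdeg : ∀ v, G.degree v ≤ d) (hedge : ∀ i j, G.Adj i j → |θe i j| ≤ β)
    (hnonedge : ∀ i j, ¬ G.Adj i j → θe i j = 0)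
    (hfield : ∀ i, |θv i| ≤ h) (v : Fin p) (x : Fin p → Bool) :
    |localField θe θv v x| ≤ β * d + h := by
  have hsum : |∑ j, θe v j * spin (x j)| ≤ β * d := by
    calc |∑ j, θe v j * spin (x j)| ≤ ∑ j, |θe v j * spin (x j)| := abs_sum_le_sum_abs _ _
      _ ≤ ∑ j, if G.Adj v j then β else 0 := by
          refine sum_le_sum fun j _ => ?_
          rw [abs_mul, abs_spin, mul_one]
          split_ifs with hj
          · exact hedge v j hj
          · simp [hnonedge v j hj]
      _ = β * G.degree v := by
          rw [← sum_filter, sum_const, nsmul_eq_mul, ← G.card_neighborFinset_eq_degree,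
            G.neighborFinset_eq_filter, mul_comm]
      _ ≤ β * d := mul_le_mul_of_nonneg_left (by exact_mod_cast hdeg v) hβ
  have := abs_add_le (θv v) (∑ j, θe v j * spin (x j))
  have := hfield v
  unfold localField
  linarith

lemma sq_le_mul_sinh (t : ℝ) : t ^ 2 ≤ t * Real.sinh t := by
  rcases le_total 0 t with ht | ht
  · nlinarith [Real.self_le_sinh_iff.2 ht]
  · nlinarith [Real.sinh_le_self_iff.2 ht]

lemma cosh_le_exp_of_abs_le {a M : ℝ} (ha : |a| ≤ M) : Real.cosh a ≤ Real.exp M := by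
  have h1 := exp_le_exp.2 ((le_abs_self a).trans ha)
  have h2 := exp_le_exp.2 ((neg_le_abs a).trans ha)
  rw [Real.cosh_eq]
  linarith

lemma exp_mul_sq_le_tanh_sub_mul_sub {a b M : ℝ} (ha : |a| ≤ M) (hb : |b| ≤ M) :
    Real.exp (-(2 * M)) * (a - b) ^ 2 ≤ (Real.tanh a - Real.tanh b) * (a - b) := by
  have hca := Real.cosh_pos a
  have hcb := Real.cosh_pos b
  have hcc : Real.cosh a * Real.cosh b ≤ Real.exp (2 * M) := by
    rw [two_mul, exp_add]
    exact mul_le_mul (cosh_le_exp_of_abs_le ha) (cosh_le_exp_of_abs_le hb) hcb.le (exp_pos _).le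
  have heq : (Real.tanh a - Real.tanh b) * (a - b)
      = ((a - b) * Real.sinh (a - b)) / (Real.cosh a * Real.cosh b) := by
    rw [Real.tanh_eq_sinh_div_cosh, Real.tanh_eq_sinh_div_cosh, Real.sinh_sub]
    field_simp
  rw [heq, exp_neg, inv_mul_eq_div]
  exact div_le_div₀ ((sq_nonneg _).trans (sq_le_mul_sinh _)) (sq_le_mul_sinh _)
    (mul_pos hca hcb) hcc

lemma exp_neg_mul_neg_sub_tanh {s : ℝ} (hs : s = 1 ∨ s = -1) (t : ℝ) :
    (s - Real.tanh t) + Real.exp (-(2 * s * t)) * (-s - Real.tanh t) = 0 := by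
  have hc := (Real.cosh_pos t).ne'
  have hexp : Real.exp t * Real.exp (-t) = 1 := by rw [← exp_add]; simp
  rw [Real.tanh_eq_sinh_div_cosh]
  field_simp
  rw [Real.sinh_eq, Real.cosh_eq]
  rcases hs with rfl | rfl
  · rw [show -(1 * 2 * t) = -t + -t by ring, exp_add]
    linear_combination (-Real.exp (-t)) * hexp
  · rw [show -(-1 * 2 * t) = t + t by ring, exp_add]
    linear_combination (Real.exp t) * hexp

/-- A nonnegative weight that is quasi-invariant under an involution `e` which moves `Z` by at
least a fixed amount has a large second moment of `Z` about any point. -/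
lemma mul_sum_le_sum_mul_sub_sq {Ω : Type*} [Fintype Ω] (e : Ω ≃ Ω) (w Z : Ω → ℝ)
    {c K : ℝ} (m : ℝ) (hw : ∀ x, 0 ≤ w x) (hc0 : 0 ≤ c) (hc1 : c ≤ 1)
    (hcw : ∀ x, c * w x ≤ w (e x)) (hZ : ∀ x, K ≤ (Z x - Z (e x)) ^ 2) :
    c * K / 4 * ∑ x, w x ≤ ∑ x, w x * (Z x - m) ^ 2 := by
  have hdouble : 2 * ∑ x, w x * (Z x - m) ^ 2
      = ∑ x, (w x * (Z x - m) ^ 2 + w (e x) * (Z (e x) - m) ^ 2) := by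
    rw [sum_add_distrib, Equiv.sum_comp e fun x => w x * (Z x - m) ^ 2]
    ring
  have hle : ∑ x, c * K / 2 * w x
      ≤ ∑ x, (w x * (Z x - m) ^ 2 + w (e x) * (Z (e x) - m) ^ 2) := by
    refine sum_le_sum fun x _ => ?_
    have h1 : c * w x * (Z x - m) ^ 2 ≤ w x * (Z x - m) ^ 2 :=
      mul_le_mul_of_nonneg_right (mul_le_of_le_one_left (hw x) hc1) (sq_nonneg _)
    have h2 := mul_le_mul_of_nonneg_right (hcw x) (sq_nonneg (Z (e x) - m))
    have h3 : K / 2 ≤ (Z x - m) ^ 2 + (Z (e x) - m) ^ 2 := by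
      nlinarith [hZ x, sq_nonneg (Z x - m + (Z (e x) - m))]
    have h4 := mul_le_mul_of_nonneg_left h3 (mul_nonneg hc0 (hw x))
    linarith
  rw [← mul_sum] at hle
  linarith

/-- For a weighted average, the covariance of `tanh (Z + C)` and `Z` dominates a multiple of the
variance of `Z` when `Z + C` is bounded. -/
lemma exp_mul_sum_sq_le_sum_tanh {Ω : Type*} [Fintype Ω] (w Z : Ω → ℝ) {C M m : ℝ}
    (hw : ∀ x, 0 ≤ w x) (hpos : 0 < ∑ x, w x) (hm : ∑ x, w x * Z x = m * ∑ x, w x)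
    (hM : ∀ x, w x ≠ 0 → |Z x + C| ≤ M) :
    Real.exp (-(2 * M)) * ∑ x, w x * (Z x - m) ^ 2
      ≤ ∑ x, w x * (Real.tanh (Z x + C) * (Z x - m)) := by
  have hmC : |m + C| ≤ M := by
    have h1 : (m + C) * ∑ x, w x = ∑ x, w x * (Z x + C) := by
      simp_rw [mul_add, sum_add_distrib, hm, ← sum_mul]
      ring
    have h2 : |m + C| * ∑ x, w x ≤ M * ∑ x, w x := by
      rw [← abs_of_pos hpos, ← abs_mul, abs_of_pos hpos, h1, mul_sum]
      refine (abs_sum_le_sum_abs _ _).trans (sum_le_sum fun x _ => ?_)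
      rw [abs_mul, abs_of_nonneg (hw x), mul_comm M]
      rcases eq_or_ne (w x) 0 with h0 | h0
      · simp [h0]
      · exact mul_le_mul_of_nonneg_left (hM x h0) (hw x)
    exact le_of_mul_le_mul_right h2 hpos
  have hcentred : ∑ x, w x * (Z x - m) = 0 := by
    simp_rw [mul_sub, sum_sub_distrib, hm, ← sum_mul]
    ring
  have hshift : ∑ x, w x * (Real.tanh (Z x + C) * (Z x - m))
      = ∑ x, w x * ((Real.tanh (Z x + C) - Real.tanh (m + C)) * (Z x - m)) := by
    have : ∑ x, w x * (Real.tanh (m + C) * (Z x - m)) = 0 := by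
      simp_rw [mul_left_comm (w _), ← mul_sum, hcentred, mul_zero]
    simp_rw [sub_mul, mul_sub (w _) (Real.tanh _ * _), sum_sub_distrib, this, sub_zero]
  rw [hshift, mul_sum]
  refine sum_le_sum fun x _ => ?_
  rcases eq_or_ne (w x) 0 with h0 | h0
  · simp [h0]
  · have := exp_mul_sq_le_tanh_sub_mul_sub (hM x h0) hmC
    rw [add_sub_add_right_eq_sub] at this
    rw [mul_left_comm]
    exact mul_le_mul_of_nonneg_left this (hw x)

/-- On an event that does not involve the spin at `v` and on which the local field at `v` is
constant, the conditional mean of that spin is the hyperbolic tangent of the local field. -/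
lemma two_mul_condProb_sub_one_eq_tanh {p : ℕ} (G : SimpleGraph (Fin p)) [DecidableRel G.Adj]
    (θe : Fin p → Fin p → ℝ) (θv : Fin p → ℝ)
    (hsym : ∀ i j, θe i j = θe j i)
    (hnonedge : ∀ i j, ¬ G.Adj i j → θe i j = 0) (v : Fin p)
    (B : (Fin p → Bool) → Prop) (hB : ∀ z, B (flipAt v z) ↔ B z)
    (hBpos : prob (isingPMF G θe θv) B ≠ 0) (t : ℝ)
    (ht : ∀ z, B z → localField θe θv v z = t) :
    2 * condProb (isingPMF G θe θv) (fun z => z v = true) B - 1 = Real.tanh t := by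
  classical
  set μ := isingPMF G θe θv with hμ
  have hmean : 2 * prob μ (fun z => z v = true ∧ B z) - prob μ B
      = ∑ z, if B z then μ z * spin (z v) else 0 := by
    unfold prob
    rw [mul_sum, ← sum_sub_distrib]
    refine sum_congr rfl fun z _ => ?_
    by_cases hz : B z <;> by_cases hzv : z v = true <;> simp [hz, hzv, spin]
    ring
  have hzero : ∑ z, (if B z then μ z * (spin (z v) - Real.tanh t) else 0) = 0 := by
    have hadd : ∑ z, ((if B z then μ z * (spin (z v) - Real.tanh t) else 0)
        + if B (flipAt v z) then μ (flipAt v z) * (spin (flipAt v z v) - Real.tanh t) else 0)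
        = 0 := by
      refine sum_eq_zero fun z _ => ?_
      by_cases hz : B z
      · rw [if_pos hz, if_pos ((hB z).2 hz), hμ, isingPMF_flipAt G θe θv hsym hnonedge, ht z hz,
          flipAt_self, spin_not]
        linear_combination
          isingPMF G θe θv z * exp_neg_mul_neg_sub_tanh (spin_eq_or (z v)) t
      · rw [if_neg hz, if_neg ((hB z).not.2 hz), add_zero]
    rw [sum_add_distrib, sum_comp_flipAt v
      fun z => if B z then μ z * (spin (z v) - Real.tanh t) else 0] at hadd
    linarith
  have hsplit : ∑ z, (if B z then μ z * (spin (z v) - Real.tanh t) else 0)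
      = (∑ z, if B z then μ z * spin (z v) else 0) - Real.tanh t * prob μ B := by
    unfold prob
    rw [mul_sum, ← sum_sub_distrib]
    refine sum_congr rfl fun z _ => ?_
    split_ifs <;> ring
  rw [hsplit, ← hmean] at hzero
  unfold condProb
  field_simp
  linarith

lemma deltaLB_pos (β h : ℝ) (d : ℕ) : 0 < deltaLB β h d := by
  unfold deltaLB
  positivity

lemma two_mul_deltaLB (β h : ℝ) (d : ℕ) :
    2 * deltaLB β h d = Real.exp (-(2 * (β * d + h))) := by
  unfold deltaLB
  ring

lemma two_mul_deltaLB_le_one {β h : ℝ} (hβ : 0 ≤ β) (hh : 0 ≤ h) (d : ℕ) :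
    2 * deltaLB β h d ≤ 1 := by
  rw [two_mul_deltaLB, exp_le_one_iff]
  have : 0 ≤ β * d := by positivity
  linarith

lemma prob_isingPMF_pos {p : ℕ} (G : SimpleGraph (Fin p)) [DecidableRel G.Adj]
    (θe : Fin p → Fin p → ℝ) (θv : Fin p → ℝ) {B : (Fin p → Bool) → Prop}
    {x : Fin p → Bool} (hx : B x) : 0 < prob (isingPMF G θe θv) B := by
  classical
  unfold prob
  refine sum_pos' (fun z _ => ?_) ⟨x, mem_univ x, ?_⟩
  · split_ifs
    · exact (isingPMF_pos G θe θv z).le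
    · exact le_rfl
  · rw [if_pos hx]
    exact isingPMF_pos G θe θv x

/-- lower bound on the key expectation. -/
theorem stmt8
    {p d : ℕ} (G : SimpleGraph (Fin p)) [DecidableRel G.Adj]
    (θe : Fin p → Fin p → ℝ) (θv : Fin p → ℝ) (α β h : ℝ)
    (hα : 0 < α) (hαβ : α ≤ β) (hh : 0 ≤ h)
    (hdeg : ∀ v, G.degree v ≤ d)
    (hsym : ∀ i j, θe i j = θe j i)
    (hedge : ∀ i j, G.Adj i j → α ≤ |θe i j| ∧ |θe i j| ≤ β)
    (hnonedge : ∀ i j, ¬ G.Adj i j → θe i j = 0)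
    (hfield : ∀ i, |θv i| ≤ h)
    (u : Fin p) (S : Finset (Fin p)) (huS : u ∉ S)
    (hU : (G.neighborFinset u \ S).Nonempty)
    (σ : Fin p → Bool)
    (hpos : 0 < prob (isingPMF G θe θv) (agree S σ)) :
    (1/2) * condExp (isingPMF G θe θv) (agree S σ) (fun x =>
        (2 * condProb (isingPMF G θe θv) (fun z => z u = true)
            (fun z => agree (G.neighborFinset u \ S) x z ∧ agree S σ z) - 1)
        * ((∑ i ∈ G.neighborFinset u \ S, θe u i * spin (x i))
            - condExp (isingPMF G θe θv) (agree S σ)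
                (fun y => ∑ i ∈ G.neighborFinset u \ S, θe u i * spin (y i))))
      ≥ α ^ 2 * deltaLB β h d ^ (4 * (G.neighborFinset u \ S).card + 1) / 8
    ∧ α ^ 2 * deltaLB β h d ^ (4 * (G.neighborFinset u \ S).card + 1) / 8
      ≥ d * β * (2 * tauStar α β h d) := by
  classical
  have hβ : 0 < β := hα.trans_le hαβ
  have hδ := deltaLB_pos β h d
  have hδ1 := two_mul_deltaLB_le_one hβ.le hh d
  have hcard : (G.neighborFinset u \ S).card ≤ d :=
    (card_le_card sdiff_subset).trans ((G.card_neighborFinset_eq_degree u).trans_le (hdeg u))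
  have hcard1 : 1 ≤ (G.neighborFinset u \ S).card := hU.card_pos
  set U := G.neighborFinset u \ S with hUdef
  set μ := isingPMF G θe θv with hμ
  set δ := deltaLB β h d with hδdef
  set Z : (Fin p → Bool) → ℝ := fun x => ∑ i ∈ U, θe u i * spin (x i) with hZ
  set m := condExp μ (agree S σ) Z with hm
  set C : ℝ := θv u + ∑ j ∈ Uᶜ, θe u j * spin (σ j) with hC
  set w : (Fin p → Bool) → ℝ := fun x => if agree S σ x then μ x else 0 with hw
  have hwA : prob μ (agree S σ) = ∑ x, w x := rfl
  rw [hwA] at hpos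
  have hmw : ∑ x, w x * Z x = m * ∑ x, w x := by
    rw [hm, condExp, hwA, div_mul_cancel₀ _ hpos.ne']
    simp_rw [hw, ite_mul, zero_mul]
  have hw0 : ∀ x, 0 ≤ w x := by
    intro x
    simp only [hw]
    split_ifs
    · exact (isingPMF_pos G θe θv x).le
    · exact le_rfl
  have hwS : ∀ x, w x ≠ 0 → agree S σ x := by
    intro x hx
    by_contra hn
    exact hx (if_neg hn)
  have huU : u ∉ U := by simp [hUdef]
  have hlocal : ∀ x z, agree U x z → agree S σ z → localField θe θv u z = Z x + C := by
    intro x z hUx hSz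
    rw [localField, ← sum_add_sum_compl U, hC]
    have h1 : ∑ i ∈ U, θe u i * spin (z i) = Z x :=
      sum_congr rfl fun i hi => by rw [hUx i hi]
    have h2 : ∑ j ∈ Uᶜ, θe u j * spin (z j) = ∑ j ∈ Uᶜ, θe u j * spin (σ j) := by
      refine sum_congr rfl fun j hj => ?_
      by_cases hadj : G.Adj u j
      · have hjS : j ∈ S := by
          by_contra hjS
          exact mem_compl.1 hj (mem_sdiff.2 ⟨(G.mem_neighborFinset u j).2 hadj, hjS⟩)
        rw [hSz j hjS]
      · rw [hnonedge u j hadj, zero_mul, zero_mul]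
    rw [h1, h2]
    ring
  have hbound := abs_localField_le G θe θv hβ.le hdeg (fun i j hij => (hedge i j hij).2) hnonedge
    hfield
  have htanh : ∀ x, agree S σ x → 2 * condProb μ (fun z => z u = true)
      (fun z => agree U x z ∧ agree S σ z) - 1 = Real.tanh (Z x + C) := by
    intro x hx
    refine two_mul_condProb_sub_one_eq_tanh G θe θv hsym hnonedge u _ (fun z => ?_)
      (prob_isingPMF_pos G θe θv ⟨fun _ _ => rfl, hx⟩).ne' _ fun z hz => hlocal x z hz.1 hz.2
    rw [agree_flipAt_iff huU, agree_flipAt_iff huS]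
  have hcov := exp_mul_sum_sq_le_sum_tanh w Z (C := C) (M := β * d + h) hw0 hpos hmw
    fun x hx => by
      rw [← hlocal x x (fun _ _ => rfl) (hwS x hx)]
      exact hbound u x
  obtain ⟨i, hiU⟩ := hU
  have hiS : i ∉ S := (mem_sdiff.1 hiU).2
  have hadj : G.Adj u i := (G.mem_neighborFinset u i).1 (mem_sdiff.1 hiU).1
  have hvar := mul_sum_le_sum_mul_sub_sq (flipAt_involutive i).toPerm w Z (c := 2 * δ)
    (K := 4 * α ^ 2) m hw0 (by positivity) hδ1
    (fun x => by
      change 2 * δ * w x ≤ w (flipAt i x)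
      simp only [hw, agree_flipAt_iff hiS]
      split_ifs
      · rw [hμ, isingPMF_flipAt G θe θv hsym hnonedge, hδdef, two_mul_deltaLB]
        refine mul_le_mul_of_nonneg_right (exp_le_exp.2 ?_) (isingPMF_pos G θe θv x).le
        have h1 : |spin (x i) * localField θe θv i x| ≤ β * d + h := by
          rw [abs_mul, abs_spin, one_mul]
          exact hbound i x
        linarith [le_abs_self (spin (x i) * localField θe θv i x)]
      · simp)
    (fun x => by
      change 4 * α ^ 2 ≤ (Z x - Z (flipAt i x)) ^ 2
      have hdiff : Z x - Z (flipAt i x) = 2 * spin (x i) * θe u i := by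
        simp_rw [hZ, spin_flipAt, mul_add, sum_add_distrib, mul_ite, mul_zero]
        rw [sum_ite_eq' U i, if_pos hiU]
        ring
      have h1 : α ^ 2 ≤ θe u i ^ 2 := by
        rw [← sq_abs (θe u i)]
        exact pow_le_pow_left₀ hα.le (hedge u i hadj).1 2
      have h2 : spin (x i) ^ 2 = 1 := by rw [← sq_abs, abs_spin, one_pow]
      rw [hdiff, mul_pow, mul_pow, h2]
      linarith)
  rw [← two_mul_deltaLB, ← hδdef] at hcov
  have hnum : ∀ F : (Fin p → Bool) → ℝ, (∀ x, agree S σ x → F x = Real.tanh (Z x + C)) →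
      2 * δ * (2 * δ * α ^ 2) ≤ condExp μ (agree S σ) (fun x => F x * (Z x - m)) := by
    intro F hF
    rw [condExp, hwA, le_div_iff₀ hpos]
    have hEq : (∑ x, if agree S σ x then μ x * (F x * (Z x - m)) else 0)
        = ∑ x, w x * (Real.tanh (Z x + C) * (Z x - m)) := by
      refine sum_congr rfl fun x _ => ?_
      simp only [hw]
      split_ifs with hx
      · rw [hF x hx]
      · rw [zero_mul]
    rw [hEq]
    have h1 := mul_le_mul_of_nonneg_left hvar (by positivity : 0 ≤ 2 * δ)
    linarith
  constructor
  · have h1 := hnum _ htanh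
    have h2 : δ ^ (4 * U.card + 1) ≤ δ ^ 2 :=
      pow_le_pow_of_le_one hδ.le (by linarith) (by omega)
    have h3 := mul_le_mul_of_nonneg_left h2 (sq_nonneg α)
    have h4 : 0 ≤ α ^ 2 * δ ^ 2 := by positivity
    change α ^ 2 * δ ^ (4 * U.card + 1) / 8 ≤ _
    linarith
  · have hd : (0 : ℝ) < d := by exact_mod_cast hcard1.trans hcard
    have h2 : δ ^ (4 * d + 1) ≤ δ ^ (4 * U.card + 1) :=
      pow_le_pow_of_le_one hδ.le (by linarith) (by omega)
    have h3 : d * β * (2 * tauStar α β h d) = α ^ 2 * δ ^ (4 * d + 1) / 8 := by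
      rw [tauStar]
      field_simp
      ring
    rw [h3]
    gcongr
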